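/- Let Ω ⊂ {(x,y) ∈ ℝ² : y < 0} be a bounded smooth domain whose boundary is tangent to the x-axis at the origin 0 = (0,0), and let F ∈ C²(cl Ω, ℝ) satisfy F(0) = F_x(0) = F_y(0) = F_xy(0) = 0, F_xx(0) < 0 and F_yy(0) > 0. Then there exist δ, η > 0 and two functions Y₁ ∈ C¹([−δ,0], [−η,0]) and Y₂ ∈ C¹([0,δ], [−η,0]) such that: (i) Y₁(0) = Y₂(0) = 0; (ii) Y₁′(0) = √(−F_xx(0)/F_yy(0)) and Y₂′(0) = −√(−F_xx(0)/F_yy(0)); (iii) for (x,y) ∈ cl Ω ∩ [−δ,δ] × [−η,0], F(x,y) = 0 if and only if (y = Y₁(x) and x ∈ [−δ,0]) or (y = Y₂(x) and x ∈ [0,δ]). -/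

import Mathlib

open Real Set MeasureTheory

noncomputable section

/-- Partial derivative in the `x` direction. -/
def pdx (u : ℝ × ℝ → ℝ) (q : ℝ × ℝ) : ℝ := fderiv ℝ u q (1, 0)

/-- Partial derivative in the `y` direction. -/
def pdy (u : ℝ × ℝ → ℝ) (q : ℝ × ℝ) : ℝ := fderiv ℝ u q (0, 1)

/-- Curvature of the level set of `u`:
`𝔎 = −(u_yy u_x² − 2 u_xy u_x u_y + u_xx u_y²)/|∇u|³`. -/
def crv (u : ℝ × ℝ → ℝ) (q : ℝ × ℝ) : ℝ :=
  -(pdy (pdy u) q * (pdx u q) ^ 2 - 2 * pdy (pdx u) q * pdx u q * pdy u q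
      + pdx (pdx u) q * (pdy u q) ^ 2) / (Real.sqrt ((pdx u q) ^ 2 + (pdy u q) ^ 2)) ^ 3

/-- The vector field
`T(q) = (u_yy u_x − u_xy u_y, u_xx u_y − u_xy u_x)(q)`. -/
def Tvec (u : ℝ × ℝ → ℝ) (q : ℝ × ℝ) : ℝ × ℝ :=
  (pdy (pdy u) q * pdx u q - pdy (pdx u) q * pdy u q,
   pdx (pdx u) q * pdy u q - pdy (pdx u) q * pdx u q)

/-- Directional derivative `u_θ = ⟨∇u, e_θ⟩`, `e_θ = (cos θ, sin θ)`. -/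
def dird (u : ℝ × ℝ → ℝ) (θ : ℝ) (q : ℝ × ℝ) : ℝ :=
  Real.cos θ * pdx u q + Real.sin θ * pdy u q

/-- `f` is of class `C^{1,α}` for some `α ∈ (0,1]` (locally Hölder derivative). -/
def C1Alpha (f : ℝ → ℝ) : Prop :=
  ContDiff ℝ 1 f ∧ ∃ α : NNReal, 0 < α ∧ α ≤ 1 ∧
    ∀ s : Set ℝ, IsCompact s → ∃ C : NNReal, HolderOnWith C α (deriv f) s

/-- `Ω` has smooth (`C^∞`) boundary: there is a global smooth defining function. -/
def SmoothBoundary (Ω : Set (ℝ × ℝ)) : Prop :=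
  ∃ ρ : ℝ × ℝ → ℝ, ContDiff ℝ (⊤ : ℕ∞) ρ ∧ Ω = {p | ρ p < 0} ∧
    ∀ p ∈ frontier Ω, ρ p = 0 ∧ fderiv ℝ ρ p ≠ 0

/-- `u ∈ C^k(cl Ω)`: `u` is `C^k` on an open neighborhood of the closure of `Ω`. -/
def ContDiffNearClosure (k : ℕ) (Ω : Set (ℝ × ℝ)) (u : ℝ × ℝ → ℝ) : Prop :=
  ∃ V : Set (ℝ × ℝ), IsOpen V ∧ closure Ω ⊆ V ∧ ContDiffOn ℝ k u V

/-- `u` solves problem (1.1): `u ∈ C³(cl Ω)`, `−Δu = f(u)` and `u > 0` in `Ω`,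
`u = 0` on `∂Ω`. -/
def SolvesPb (Ω : Set (ℝ × ℝ)) (f : ℝ → ℝ) (u : ℝ × ℝ → ℝ) : Prop :=
  ContDiffNearClosure 3 Ω u ∧
  (∀ q ∈ Ω, pdx (pdx u) q + pdy (pdy u) q = -f (u q)) ∧
  (∀ q ∈ Ω, 0 < u q) ∧
  (∀ q ∈ frontier Ω, u q = 0)

/-- `u` is semi-stable: `∫_Ω |∇φ|² − ∫_Ω f′(u) φ² ≥ 0` for all `φ ∈ C_c^∞(Ω)`. -/
def SemiStable (Ω : Set (ℝ × ℝ)) (f : ℝ → ℝ) (u : ℝ × ℝ → ℝ) : Prop :=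
  ∀ φ : ℝ × ℝ → ℝ, ContDiff ℝ (⊤ : ℕ∞) φ → HasCompactSupport φ → tsupport φ ⊆ Ω →
    0 ≤ (∫ x in Ω, ‖fderiv ℝ φ x‖ ^ 2) - ∫ x in Ω, deriv f (u x) * φ x ^ 2

namespace PlaneZeroSet

open Filter Topology Asymptotics

/-- The continuous linear functional `(u, v) ↦ α u + β v` on the plane. -/
def planeForm (α β : ℝ) : ℝ × ℝ →L[ℝ] ℝ :=
  α • ContinuousLinearMap.fst ℝ ℝ ℝ + β • ContinuousLinearMap.snd ℝ ℝ ℝ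

lemma planeForm_apply (α β : ℝ) (v : ℝ × ℝ) : planeForm α β v = α * v.1 + β * v.2 := by
  simp [planeForm]

lemma hasFDerivAt_planeForm {F : ℝ × ℝ → ℝ} {p : ℝ × ℝ} (hF : DifferentiableAt ℝ F p) :
    HasFDerivAt F (planeForm (pdx F p) (pdy F p)) p := by
  have h : planeForm (pdx F p) (pdy F p) = fderiv ℝ F p := by
    ext <;> simp [planeForm, pdx, pdy]
  rw [h]
  exact hF.hasFDerivAt

lemma hasDerivAt_snd_of_planeForm {F : ℝ × ℝ → ℝ} {α β x y : ℝ}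
    (hF : HasFDerivAt F (planeForm α β) (x, y)) : HasDerivAt (fun t => F (x, t)) β y := by
  have h := hF.comp_hasDerivAt y ((hasDerivAt_const y x).prodMk (hasDerivAt_id y))
  rw [planeForm_apply, mul_zero, zero_add, mul_one] at h
  exact h

/-- A continuous solution of `F (x, Y x) = 0` is differentiable where `F_y ≠ 0`. -/
lemma hasDerivAt_of_implicit {F : ℝ × ℝ → ℝ} {Y : ℝ → ℝ} {α β x₀ : ℝ}
    (hF : HasFDerivAt F (planeForm α β) (x₀, Y x₀)) (hβ : β ≠ 0) (hY : ContinuousAt Y x₀)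
    (hzero : ∀ᶠ x in 𝓝 x₀, F (x, Y x) = 0) : HasDerivAt Y (-α / β) x₀ := by
  have hto : Tendsto (fun x => (x, Y x)) (𝓝 x₀) (𝓝 (x₀, Y x₀)) :=
    (continuousAt_id.prodMk hY)
  have hlin := (hF.isLittleO.comp_tendsto hto)
  rw [hasDerivAt_iff_isLittleO, isLittleO_iff]
  intro ε hε
  set m := |α / β| with hm
  have hm0 : 0 ≤ m := abs_nonneg _
  set c := min (1 / 2) (ε / (2 * (1 + m))) with hc
  have hc0 : 0 < c := by positivity
  have hc1 : c ≤ 1 / 2 := min_le_left _ _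
  have hc2 : c * (2 * (1 + m)) ≤ ε := by
    rw [← le_div_iff₀ (by positivity)]
    exact min_le_right _ _
  have hcβ : 0 < c * |β| := mul_pos hc0 (abs_pos.2 hβ)
  filter_upwards [(isLittleO_iff.1 hlin) hcβ, hzero] with x hx hx0
  have hx00 := hzero.self_of_nhds
  simp only [Function.comp, hx0, hx00, planeForm_apply, Prod.fst_sub, Prod.snd_sub,
    Prod.norm_def, Real.norm_eq_abs] at hx
  simp only [smul_eq_mul, Real.norm_eq_abs]
  set w := Y x - Y x₀ - (x - x₀) * (-α / β) with hw
  have hwβ : 0 - 0 - (α * (x - x₀) + β * (Y x - Y x₀)) = -(β * w) := by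
    rw [hw]; field_simp; ring
  rw [hwβ, abs_neg, abs_mul] at hx
  have hw1 : |w| ≤ c * max |x - x₀| |Y x - Y x₀| := by
    have := abs_pos.2 hβ
    nlinarith
  have hdy : |Y x - Y x₀| ≤ |w| + m * |x - x₀| := by
    have h : Y x - Y x₀ = w - α / β * (x - x₀) := by rw [hw]; ring
    rw [h, hm, ← abs_mul]
    exact abs_sub _ _
  have hmax : max |x - x₀| |Y x - Y x₀| ≤ |w| + (1 + m) * |x - x₀| := by
    have := abs_nonneg w
    have := abs_nonneg (x - x₀)
    apply max_le <;> nlinarith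
  have h1 : |w| ≤ c * |w| + c * ((1 + m) * |x - x₀|) := by nlinarith
  have h2 : c * |w| ≤ 1 / 2 * |w| := by gcongr
  have h3 : c * (2 * (1 + m)) * |x - x₀| ≤ ε * |x - x₀| := by gcongr
  nlinarith

/-- Second order Taylor expansion at a critical zero with diagonal Hessian. -/
lemma isLittleO_quadratic {F P Q : ℝ × ℝ → ℝ} {a b : ℝ}
    (hF : ∀ᶠ p in 𝓝 (0 : ℝ × ℝ), HasFDerivAt F (planeForm (P p) (Q p)) p) (hF0 : F 0 = 0)
    (hP : (fun p : ℝ × ℝ => P p - a * p.1) =o[𝓝 0] fun p => p)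
    (hQ : (fun p : ℝ × ℝ => Q p - b * p.2) =o[𝓝 0] fun p => p) :
    (fun p : ℝ × ℝ => F p - (a * p.1 ^ 2 + b * p.2 ^ 2) / 2) =o[𝓝 0] fun p => ‖p‖ ^ 2 := by
  rw [isLittleO_iff]
  intro ε hε
  have hε2 : 0 < ε / 2 := by positivity
  obtain ⟨r, hr, hball⟩ := Metric.eventually_nhds_iff_ball.1
    (hF.and ((isLittleO_iff.1 hP hε2).and (isLittleO_iff.1 hQ hε2)))
  filter_upwards [Metric.ball_mem_nhds (0 : ℝ × ℝ) hr] with p hp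
  have hder : ∀ q ∈ Metric.closedBall (0 : ℝ × ℝ) ‖p‖,
      HasFDerivWithinAt (fun q : ℝ × ℝ => F q - (a * q.1 ^ 2 + b * q.2 ^ 2) / 2)
        (planeForm (P q - a * q.1) (Q q - b * q.2)) (Metric.closedBall (0 : ℝ × ℝ) ‖p‖) q := by
    intro q hq
    have hq' : q ∈ Metric.ball (0 : ℝ × ℝ) r := by
      simp only [Metric.mem_closedBall, Metric.mem_ball, dist_zero_right] at hq hp ⊢
      exact hq.trans_lt hp
    have h := (hball q hq').1.sub (((((hasFDerivAt_fst (𝕜 := ℝ) (p := q)).pow 2).const_mul a).add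
      (((hasFDerivAt_snd (𝕜 := ℝ) (p := q)).pow 2).const_mul b)).mul_const (1 / 2))
    have h' := h.congr_fderiv (g' := planeForm (P q - a * q.1) (Q q - b * q.2)) (by
      ext <;> simp [planeForm] <;> ring)
    refine (h'.congr_of_eventuallyEq (Eventually.of_forall fun z => ?_)).hasFDerivWithinAt
    simp
    ring
  obtain ⟨z, hz, hzeq⟩ := domain_mvt hder (convex_closedBall _ _)
    (Metric.mem_closedBall_self (norm_nonneg p)) (show p ∈ _ by simp)
  have hzp : ‖z‖ ≤ ‖p‖ := by
    simpa using (convex_closedBall (0 : ℝ × ℝ) ‖p‖).segment_subset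
      (Metric.mem_closedBall_self (norm_nonneg p)) (show p ∈ _ by simp) hz
  have hz' : z ∈ Metric.ball (0 : ℝ × ℝ) r := by
    simp only [Metric.mem_ball, dist_zero_right] at hp ⊢
    exact hzp.trans_lt hp
  obtain ⟨-, hPz, hQz⟩ := hball z hz'
  simp only [hF0, Prod.fst_zero, Prod.snd_zero, sub_zero, planeForm_apply] at hzeq
  norm_num at hzeq
  rw [hzeq]
  have h1 : ‖p.1‖ ≤ ‖p‖ := norm_fst_le p
  have h2 : ‖p.2‖ ≤ ‖p‖ := norm_snd_le p
  calc ‖(P z - a * z.1) * p.1 + (Q z - b * z.2) * p.2‖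
      ≤ ‖P z - a * z.1‖ * ‖p.1‖ + ‖Q z - b * z.2‖ * ‖p.2‖ := by
        rw [← norm_mul, ← norm_mul]; exact norm_add_le _ _
    _ ≤ (ε / 2 * ‖p‖) * ‖p‖ + (ε / 2 * ‖p‖) * ‖p‖ := by
        gcongr
        · exact hPz.trans (by gcongr)
        · exact hQz.trans (by gcongr)
    _ = ε * ‖‖p‖ ^ 2‖ := by simp; ring

/-- A function with strictly increasing derivative that is positive at `-η` and negative at `0`
has a single zero in between, and it is decreasing there. -/
lemma exists_zero_of_strictMonoOn_deriv {f g : ℝ → ℝ} {η : ℝ} (hη : 0 < η)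
    (hf : ∀ y ∈ Icc (-η) 0, HasDerivAt f (g y) y) (hg : StrictMonoOn g (Icc (-η) 0))
    (hleft : 0 < f (-η)) (hright : f 0 < 0) :
    ∃ c ∈ Icc (-η) 0, f c = 0 ∧ g c < 0 ∧ (∀ y ∈ Icc (-η) 0, y < c → 0 < f y) ∧
      ∀ y ∈ Icc (-η) 0, c < y → f y < 0 := by
  have hcont : ContinuousOn f (Icc (-η) 0) := fun y hy => (hf y hy).continuousAt.continuousWithinAt
  have hmvt : ∀ u ∈ Icc (-η) 0, ∀ v ∈ Icc (-η) 0, u < v →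
      ∃ ξ ∈ Ioo u v, g ξ * (v - u) = f v - f u := by
    intro u hu v hv huv
    obtain ⟨ξ, hξ, h⟩ := exists_hasDerivAt_eq_slope f g huv
      (hcont.mono (Icc_subset_Icc hu.1 hv.2))
      (fun y hy => hf y ⟨hu.1.trans hy.1.le, hy.2.le.trans hv.2⟩)
    refine ⟨ξ, hξ, ?_⟩
    rw [h, div_mul_cancel₀ _ (sub_pos.2 huv).ne']
  obtain ⟨c, hc, hfc⟩ := intermediate_value_Icc' (by linarith : -η ≤ 0) hcont ⟨hright.le, hleft.le⟩
  have h0 : (0 : ℝ) ∈ Icc (-η) 0 := ⟨by linarith, le_rfl⟩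
  have hc0 : c < 0 := lt_of_le_of_ne hc.2 (fun h => by rw [h] at hfc; linarith)
  have hgc : g c < 0 := by
    obtain ⟨ξ, hξ, h⟩ := hmvt c hc 0 h0 hc0
    have hlt := hg hc ⟨hc.1.trans hξ.1.le, hξ.2.le⟩ hξ.1
    by_contra! hcon
    nlinarith
  refine ⟨c, hc, hfc, hgc, fun y hy hyc => ?_, fun y hy hcy => ?_⟩
  · obtain ⟨ξ, hξ, h⟩ := hmvt y hy c hc hyc
    have hlt := hg ⟨hy.1.trans hξ.1.le, hξ.2.le.trans hc.2⟩ hc hξ.2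
    nlinarith [hξ.1, hξ.2]
  · by_contra! hcon
    have hy0 : y < 0 := lt_of_le_of_ne hy.2 (fun h => by rw [h] at hcon; linarith)
    obtain ⟨ξ, hξ, h⟩ := hmvt c hc y hy hcy
    obtain ⟨ζ, hζ, h'⟩ := hmvt y hy 0 h0 hy0
    have hlt := hg ⟨hc.1.trans hξ.1.le, hξ.2.le.trans hy.2⟩ ⟨hy.1.trans hζ.1.le, hζ.2.le⟩
      (hξ.2.trans hζ.1)
    have : 0 ≤ g ξ := by by_contra! hcon'; nlinarith
    nlinarith

/-- `Y` picks, for `|x| < δ`, the point of `[-η, 0]` where `F (x, ·)` changes sign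
from positive to negative (only vanishing there). -/
structure IsSignBranch (F : ℝ × ℝ → ℝ) (δ η : ℝ) (Y : ℝ → ℝ) : Prop where
  mem : ∀ x, |x| < δ → Y x ∈ Icc (-η) 0
  zero : ∀ x, |x| < δ → F (x, Y x) = 0
  pos : ∀ x, |x| < δ → ∀ y ∈ Icc (-η) 0, y < Y x → 0 < F (x, y)
  neg : ∀ x, |x| < δ → ∀ y ∈ Icc (-η) 0, Y x < y → F (x, y) < 0

lemma IsSignBranch.lt_of_pos {F : ℝ × ℝ → ℝ} {δ η : ℝ} {Y : ℝ → ℝ} (h : IsSignBranch F δ η Y)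
    {x y : ℝ} (hx : |x| < δ) (hy : y ∈ Icc (-η) 0) (hF : 0 < F (x, y)) : y < Y x := by
  rcases lt_trichotomy y (Y x) with hlt | heq | hgt
  · exact hlt
  · rw [heq, h.zero x hx] at hF; exact absurd hF (lt_irrefl _)
  · exact absurd (h.neg x hx y hy hgt) hF.not_gt

lemma IsSignBranch.lt_of_neg {F : ℝ × ℝ → ℝ} {δ η : ℝ} {Y : ℝ → ℝ} (h : IsSignBranch F δ η Y)
    {x y : ℝ} (hx : |x| < δ) (hy : y ∈ Icc (-η) 0) (hF : F (x, y) < 0) : Y x < y := by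
  rcases lt_trichotomy y (Y x) with hlt | heq | hgt
  · exact absurd (h.pos x hx y hy hlt) hF.not_gt
  · rw [heq, h.zero x hx] at hF; exact absurd hF (lt_irrefl _)
  · exact hgt

lemma IsSignBranch.eq_zero_iff {F : ℝ × ℝ → ℝ} {δ η : ℝ} {Y : ℝ → ℝ} (h : IsSignBranch F δ η Y)
    {x y : ℝ} (hx : |x| < δ) (hy : y ∈ Icc (-η) 0) : F (x, y) = 0 ↔ y = Y x := by
  refine ⟨fun hF => ?_, fun hyx => hyx ▸ h.zero x hx⟩
  rcases lt_trichotomy y (Y x) with hlt | heq | hgt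
  · exact absurd hF (h.pos x hx y hy hlt).ne'
  · exact heq
  · exact absurd hF (h.neg x hx y hy hgt).ne

lemma eventually_abs_lt {δ x₀ : ℝ} (hx₀ : |x₀| < δ) : ∀ᶠ x in 𝓝 x₀, |x| < δ :=
  continuous_abs.continuousAt.eventually_lt_const hx₀

lemma IsSignBranch.continuousAt {F : ℝ × ℝ → ℝ} {δ η : ℝ} {Y : ℝ → ℝ}
    (h : IsSignBranch F δ η Y)
    (hF : ∀ x, |x| < δ → ∀ y ∈ Icc (-η) 0, ContinuousAt F (x, y))
    {x₀ : ℝ} (hx₀ : |x₀| < δ) : ContinuousAt Y x₀ := by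
  have hcont : ∀ y ∈ Icc (-η) 0, ContinuousAt (fun x => F (x, y)) x₀ := fun y hy =>
    ContinuousAt.comp (f := fun x : ℝ => (x, y)) (hF x₀ hx₀ y hy) (continuousAt_id.prodMk continuousAt_const)
  have hYx₀ := h.mem x₀ hx₀
  refine tendsto_order.2 ⟨fun l hl => ?_, fun u hu => ?_⟩
  · by_cases hlη : l < -η
    · filter_upwards [eventually_abs_lt hx₀] with x hx using hlη.trans_le (h.mem x hx).1
    · have hlmem : l ∈ Icc (-η) 0 := ⟨not_lt.1 hlη, hl.le.trans hYx₀.2⟩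
      filter_upwards [eventually_abs_lt hx₀,
        (hcont l hlmem).eventually_const_lt (h.pos x₀ hx₀ l hlmem hl)] with x hx hFx
      exact h.lt_of_pos hx hlmem hFx
  · by_cases hu0 : 0 < u
    · filter_upwards [eventually_abs_lt hx₀] with x hx using (h.mem x hx).2.trans_lt hu0
    · have humem : u ∈ Icc (-η) 0 := ⟨hYx₀.1.trans hu.le, not_lt.1 hu0⟩
      filter_upwards [eventually_abs_lt hx₀,
        (hcont u humem).eventually_lt_const (h.neg x₀ hx₀ u humem hu)] with x hx hFx
      exact h.lt_of_neg hx humem hFx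

lemma exists_isSignBranch {F P Q : ℝ × ℝ → ℝ} {r : ℝ} (hr : 0 < r)
    (hF : ∀ p ∈ Metric.ball (0 : ℝ × ℝ) r, HasFDerivAt F (planeForm (P p) (Q p)) p)
    (hQ : ∀ x, |x| < r → StrictMonoOn (fun y => Q (x, y)) (Ioo (-r) r))
    (hF0 : F 0 = 0) (hneg : ∀ x, x ≠ 0 → |x| < r → F (x, 0) < 0)
    (hpos : ∀ y, y ≠ 0 → |y| < r → 0 < F (0, y)) :
    ∃ δ > 0, ∃ η > 0, δ < r ∧ η < r ∧ ∃ Y : ℝ → ℝ, IsSignBranch F δ η Y ∧ Y 0 = 0 ∧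
      ∀ x, |x| < δ → x ≠ 0 → Q (x, Y x) < 0 := by
  have hηr : |-(r / 2)| < r := by rw [abs_neg, abs_of_pos (by positivity)]; linarith
  have hball : ∀ x y : ℝ, |x| < r → |y| < r → (x, y) ∈ Metric.ball (0 : ℝ × ℝ) r := by
    intro x y hx hy
    simpa [Prod.norm_def] using And.intro hx hy
  have hcont : ContinuousAt (fun x => F (x, -(r / 2))) 0 :=
    ContinuousAt.comp (f := fun x : ℝ => (x, -(r / 2)))
      (hF _ (hball 0 _ (by simpa using hr) hηr)).continuousAt
      (continuousAt_id.prodMk continuousAt_const)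
  obtain ⟨δ, hδ, hδpos⟩ := Metric.eventually_nhds_iff.1
    (hcont.eventually_const_lt (hpos _ (by linarith : -(r / 2) < 0).ne hηr))
  have key : ∀ x : ℝ, |x| < min δ (r / 2) → ∃ c ∈ Icc (-(r / 2)) 0, F (x, c) = 0 ∧
      (x = 0 → c = 0) ∧ (x ≠ 0 → Q (x, c) < 0) ∧
      (∀ y ∈ Icc (-(r / 2)) 0, y < c → 0 < F (x, y)) ∧
      ∀ y ∈ Icc (-(r / 2)) 0, c < y → F (x, y) < 0 := by
    intro x hx
    have hxδ : |x| < δ := hx.trans_le (min_le_left _ _)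
    have hxr : |x| < r := by linarith [hx.trans_le (min_le_right _ _)]
    have hIcc : ∀ y ∈ Icc (-(r / 2)) 0, |y| < r := fun y hy =>
      abs_lt.2 ⟨by linarith [hy.1], by linarith [hy.2]⟩
    by_cases hx0 : x = 0
    · subst hx0
      refine ⟨0, ⟨by linarith, le_rfl⟩, hF0, fun _ => rfl, fun h => absurd rfl h,
        fun y hy hy0 => hpos y hy0.ne (hIcc y hy), fun y hy hy0 => absurd hy.2 hy0.not_ge⟩
    · obtain ⟨c, hc, hfc, hgc, h1, h2⟩ := exists_zero_of_strictMonoOn_deriv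
        (f := fun y => F (x, y)) (g := fun y => Q (x, y)) (half_pos hr)
        (fun y hy => hasDerivAt_snd_of_planeForm (hF _ (hball x y hxr (hIcc y hy))))
        ((hQ x hxr).mono fun y hy => abs_lt.1 (hIcc y hy))
        (hδpos (by simpa using hxδ)) (hneg x hx0 hxr)
      exact ⟨c, hc, hfc, fun h => absurd h hx0, fun _ => hgc, h1, h2⟩
  choose! Y hmem hzero h0 hQneg hp hn using key
  refine ⟨min δ (r / 2), by positivity, r / 2, by positivity,
    (min_le_right _ _).trans_lt (by linarith), by linarith, Y, ⟨hmem, hzero, hp, hn⟩,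
    h0 0 (by rw [abs_zero]; positivity) rfl, hQneg⟩

lemma tendsto_div_sq_of_isLittleO {F : ℝ × ℝ → ℝ} {a b : ℝ}
    (hT : (fun p : ℝ × ℝ => F p - (a * p.1 ^ 2 + b * p.2 ^ 2) / 2) =o[𝓝 0] fun p => ‖p‖ ^ 2)
    (k : ℝ) :
    Tendsto (fun x => F (x, k * |x|) / x ^ 2) (𝓝[≠] 0) (𝓝 ((a + b * k ^ 2) / 2)) := by
  have hto : Tendsto (fun x : ℝ => (x, k * |x|)) (𝓝[≠] 0) (𝓝 0) := by
    have : Continuous fun x : ℝ => (x, k * |x|) := by fun_prop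
    exact tendsto_nhdsWithin_of_tendsto_nhds (by simpa [← Prod.zero_eq_mk] using this.tendsto 0)
  have hO : (fun x : ℝ => ‖(x, k * |x|)‖ ^ 2) =O[𝓝[≠] 0] fun x => x ^ 2 := by
    refine IsBigO.pow (IsBigO.norm_left ?_) 2
    refine (isBigO_refl _ _).prod_left ?_
    exact (isBigO_refl (fun x : ℝ => x) _).abs_left.const_mul_left k
  have h := ((hT.comp_tendsto hto).trans_isBigO hO).tendsto_div_nhds_zero
  have h' := h.add_const ((a + b * k ^ 2) / 2)
  rw [zero_add] at h'
  refine h'.congr' ?_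
  filter_upwards [self_mem_nhdsWithin] with x hx
  have hx' : x ≠ 0 := hx
  simp only [Function.comp, mul_pow, sq_abs]
  field_simp
  ring

/-- Along both sides, the branch leaves the origin tangentially to `y = -s |x|`. -/
lemma IsSignBranch.tendsto_div_abs {F : ℝ × ℝ → ℝ} {δ η a b s : ℝ} {Y : ℝ → ℝ}
    (h : IsSignBranch F δ η Y) (hδ : 0 < δ) (hη : 0 < η) (hb : 0 < b) (hs : 0 < s)
    (habs : a + b * s ^ 2 = 0)
    (hT : (fun p : ℝ × ℝ => F p - (a * p.1 ^ 2 + b * p.2 ^ 2) / 2) =o[𝓝 0] fun p => ‖p‖ ^ 2) :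
    Tendsto (fun x => Y x / |x|) (𝓝[≠] 0) (𝓝 (-s)) := by
  have hxδ : ∀ᶠ x in 𝓝[≠] (0 : ℝ), |x| < δ :=
    eventually_nhdsWithin_of_eventually_nhds (eventually_abs_lt (by simpa using hδ))
  have hmem : ∀ k ≤ 0, ∀ᶠ x in 𝓝[≠] (0 : ℝ), k * |x| ∈ Icc (-η) 0 := by
    intro k hk
    have hc : ContinuousAt (fun x : ℝ => k * |x|) 0 := by fun_prop
    filter_upwards [eventually_nhdsWithin_of_eventually_nhds
      (hc.eventually_const_lt (by simpa using hη : -η < k * |(0 : ℝ)|))] with x hx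
    exact ⟨hx.le, mul_nonpos_of_nonpos_of_nonneg hk (abs_nonneg x)⟩
  refine tendsto_order.2 ⟨fun l hl => ?_, fun u hu => ?_⟩
  · have hlim : 0 < (a + b * l ^ 2) / 2 := by
      have : s ^ 2 < l ^ 2 := by nlinarith
      nlinarith
    filter_upwards [hxδ, hmem l (by linarith), self_mem_nhdsWithin,
      (tendsto_div_sq_of_isLittleO hT l).eventually_const_lt hlim] with x hx hm hx0 hF
    have hx0' : 0 < |x| := abs_pos.2 hx0
    rw [lt_div_iff₀ hx0']
    exact h.lt_of_pos hx hm ((div_pos_iff_of_pos_right (by rw [← sq_abs]; positivity)).1 hF)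
  · by_cases hu0 : 0 < u
    · filter_upwards [hxδ] with x hx
      exact (div_nonpos_of_nonpos_of_nonneg (h.mem x hx).2 (abs_nonneg x)).trans_lt hu0
    · have hlim : (a + b * u ^ 2) / 2 < 0 := by
        have : u ^ 2 < s ^ 2 := by nlinarith
        nlinarith
      filter_upwards [hxδ, hmem u (not_lt.1 hu0), self_mem_nhdsWithin,
        (tendsto_div_sq_of_isLittleO hT u).eventually_lt_const hlim] with x hx hm hx0 hF
      have hx0' : 0 < |x| := abs_pos.2 hx0
      rw [div_lt_iff₀ hx0']
      refine h.lt_of_neg hx hm ?_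
      have hx2 : 0 < x ^ 2 := by rw [← sq_abs]; positivity
      by_contra! hcon
      exact absurd (div_nonneg hcon hx2.le) hF.not_ge

/-- The slope `-F_x / F_y` along a branch with tangent of slope `m` tends to `m`. -/
lemma tendsto_neg_div_of_tendsto_div {P Q : ℝ × ℝ → ℝ} {Y : ℝ → ℝ} {a b m : ℝ} {l : Filter ℝ}
    (hl : l ≤ 𝓝[≠] 0) (hb : b ≠ 0) (hm : m ≠ 0) (ham : a + b * m ^ 2 = 0)
    (hP : (fun p : ℝ × ℝ => P p - a * p.1) =o[𝓝 0] fun p => p)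
    (hQ : (fun p : ℝ × ℝ => Q p - b * p.2) =o[𝓝 0] fun p => p)
    (hY : Tendsto (fun x => Y x / x) l (𝓝 m)) :
    Tendsto (fun x => -P (x, Y x) / Q (x, Y x)) l (𝓝 m) := by
  have hne : ∀ᶠ x in l, x ≠ 0 := hl self_mem_nhdsWithin
  have hid : Tendsto (fun x : ℝ => x) l (𝓝 0) := hl.trans nhdsWithin_le_nhds
  have hY0 : Tendsto Y l (𝓝 0) := by
    have h := hY.mul hid
    rw [mul_zero] at h
    refine h.congr' ?_
    filter_upwards [hne] with x hx using div_mul_cancel₀ _ hx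
  have hto : Tendsto (fun x => (x, Y x)) l (𝓝 (0 : ℝ × ℝ)) := hid.prodMk_nhds hY0
  have hYO : Y =O[l] fun x => x :=
    isBigO_of_div_tendsto_nhds (hne.mono fun x hx h => absurd h hx) m hY
  have hO : (fun x => (x, Y x)) =O[l] fun x => x := (isBigO_refl _ _).prod_left hYO
  have hP' := ((hP.comp_tendsto hto).trans_isBigO hO).tendsto_div_nhds_zero.add_const a
  have hQ' := ((hQ.comp_tendsto hto).trans_isBigO hO).tendsto_div_nhds_zero.add (hY.const_mul b)
  rw [zero_add] at hP' hQ'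
  have hdiv := hP'.neg.div hQ' (mul_ne_zero hb hm)
  have hlim : -a / (b * m) = m := by
    rw [div_eq_iff (mul_ne_zero hb hm)]
    linear_combination -ham
  rw [hlim] at hdiv
  refine hdiv.congr' ?_
  filter_upwards [hne] with x hx
  have h1 : (P (x, Y x) - a * x) / x + a = P (x, Y x) / x := by field_simp; ring
  have h2 : (Q (x, Y x) - b * Y x) / x + b * (Y x / x) = Q (x, Y x) / x := by field_simp; ring
  simp only [Function.comp, Pi.div_apply]
  rw [h1, h2, ← neg_div, div_div_div_cancel_right₀ hx]

/-- A function whose derivative off `0` tends to its slope at `0` is `C¹`. -/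
lemma contDiffOn_one_of_punctured {Y D : ℝ → ℝ} {S : Set ℝ} {m : ℝ} (hS : UniqueDiffOn ℝ S)
    (h0 : (0 : ℝ) ∈ S) (hY0 : Y 0 = 0)
    (hYD : ∀ x ∈ S, x ≠ 0 → HasDerivAt Y (D x) x) (hD : ∀ x ∈ S, x ≠ 0 → ContinuousAt D x)
    (hslope : Tendsto (fun x => Y x / x) (𝓝[S \ {0}] 0) (𝓝 m))
    (hlim : Tendsto D (𝓝[S \ {0}] 0) (𝓝 m)) :
    ContDiffOn ℝ 1 Y S ∧ derivWithin Y S 0 = m := by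
  have hder : ∀ x ∈ S, HasDerivWithinAt Y (Function.update D 0 m x) S x := by
    intro x hx
    rcases eq_or_ne x 0 with rfl | hx0
    · rw [Function.update_self, hasDerivWithinAt_iff_tendsto_slope]
      refine hslope.congr fun x => ?_
      simp [slope_def_field, hY0]
    · rw [Function.update_of_ne hx0]
      exact (hYD x hx hx0).hasDerivWithinAt
  have hEq : EqOn (derivWithin Y S) (Function.update D 0 m) S := fun x hx =>
    (hder x hx).derivWithin (hS x hx)
  refine ⟨(contDiffOn_one_iff_derivWithin hS).2
    ⟨fun x hx => (hder x hx).differentiableWithinAt, ContinuousOn.congr (fun x hx => ?_) hEq⟩,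
    by rw [hEq h0, Function.update_self]⟩
  rcases eq_or_ne x 0 with rfl | hx0
  · exact continuousWithinAt_update_same.2 hlim
  · exact ((continuousAt_update_of_ne hx0).2 (hD x hx hx0)).continuousWithinAt

lemma contDiffAt_pdx {F : ℝ × ℝ → ℝ} {p : ℝ × ℝ} (hF : ContDiffAt ℝ 2 F p) :
    ContDiffAt ℝ 1 (pdx F) p :=
  (hF.fderiv_right (m := 1) (by norm_num)).clm_apply contDiffAt_const

lemma contDiffAt_pdy {F : ℝ × ℝ → ℝ} {p : ℝ × ℝ} (hF : ContDiffAt ℝ 2 F p) :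
    ContDiffAt ℝ 1 (pdy F) p :=
  (hF.fderiv_right (m := 1) (by norm_num)).clm_apply contDiffAt_const

/-- Equality of mixed partial derivatives. -/
lemma pdx_pdy_eq {F : ℝ × ℝ → ℝ} {p : ℝ × ℝ} (hF : ContDiffAt ℝ 2 F p) :
    pdx (pdy F) p = pdy (pdx F) p := by
  have hd : DifferentiableAt ℝ (fderiv ℝ F) p :=
    (hF.fderiv_right (m := 1) (by norm_num)).differentiableAt one_ne_zero
  have happly : ∀ v w : ℝ × ℝ,
      fderiv ℝ (fun q => fderiv ℝ F q v) p w = fderiv ℝ (fderiv ℝ F) p w v := by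
    intro v w
    have h := (hd.hasFDerivAt.clm_apply (hasFDerivAt_const v p)).fderiv
    rw [h]
    simp
  have hsymm : IsSymmSndFDerivAt ℝ F p := hF.isSymmSndFDerivAt (by simp)
  exact (happly _ _).trans ((hsymm _ _).trans (happly _ _).symm)

lemma isLittleO_sub_linear {g : ℝ × ℝ → ℝ} (hg : DifferentiableAt ℝ g 0) (hg0 : g 0 = 0) :
    (fun p : ℝ × ℝ => g p - (pdx g 0 * p.1 + pdy g 0 * p.2)) =o[𝓝 0] fun p => p := by
  simpa [hg0, planeForm_apply] using (hasFDerivAt_planeForm hg).isLittleO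

/-- The two branches at a saddle point, glued to a single function `Y`. -/
lemma exists_zero_branch {F : ℝ × ℝ → ℝ} (hF : ContDiffAt ℝ 2 F 0) (hF0 : F 0 = 0)
    (hFx : pdx F 0 = 0) (hFy : pdy F 0 = 0) (hFxy : pdy (pdx F) 0 = 0)
    (hFxx : pdx (pdx F) 0 < 0) (hFyy : 0 < pdy (pdy F) 0) {s : ℝ} (hs : 0 < s)
    (hs2 : pdx (pdx F) 0 + pdy (pdy F) 0 * s ^ 2 = 0) :
    ∃ δ > 0, ∃ η > 0, ∃ Y : ℝ → ℝ, IsSignBranch F δ η Y ∧ Y 0 = 0 ∧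
      Tendsto (fun x => Y x / |x|) (𝓝[≠] 0) (𝓝 (-s)) ∧
      ∀ (S : Set ℝ) (m : ℝ), UniqueDiffOn ℝ S → 0 ∈ S → (∀ x ∈ S, |x| < δ) →
        m ≠ 0 → m ^ 2 = s ^ 2 →
        Tendsto (fun x => Y x / x) (𝓝[S \ {0}] 0) (𝓝 m) →
        ContDiffOn ℝ 1 Y S ∧ derivWithin Y S 0 = m := by
  set a := pdx (pdx F) 0 with ha
  set b := pdy (pdy F) 0 with hb
  have hP1 := contDiffAt_pdx hF
  have hQ1 := contDiffAt_pdy hF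
  have hP : (fun p : ℝ × ℝ => pdx F p - a * p.1) =o[𝓝 0] fun p => p := by
    simpa [hFxy] using isLittleO_sub_linear (hP1.differentiableAt one_ne_zero) hFx
  have hQ : (fun p : ℝ × ℝ => pdy F p - b * p.2) =o[𝓝 0] fun p => p := by
    simpa [pdx_pdy_eq hF, hFxy] using isLittleO_sub_linear (hQ1.differentiableAt one_ne_zero) hFy
  have hC2 : ∀ᶠ p in 𝓝 (0 : ℝ × ℝ), ContDiffAt ℝ 2 F p := hF.eventually (by simp)
  have hder : ∀ {p : ℝ × ℝ}, ContDiffAt ℝ 2 F p →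
      HasFDerivAt F (planeForm (pdx F p) (pdy F p)) p := fun h =>
    hasFDerivAt_planeForm (h.differentiableAt two_ne_zero)
  have hT := isLittleO_quadratic (hC2.mono fun p => hder) hF0 hP hQ
  have hyy : ∀ᶠ p in 𝓝 (0 : ℝ × ℝ), 0 < pdy (pdy F) p := by
    have hc : ContinuousAt (pdy (pdy F)) 0 :=
      ((hQ1.fderiv_right (m := 0) (by norm_num)).continuousAt).clm_apply continuousAt_const
    exact hc.eventually_const_lt hFyy
  have hε : 0 < min (-a) b / 4 := by have := lt_min (neg_pos.2 hFxx) hFyy; positivity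
  obtain ⟨r, hr, hball⟩ := Metric.eventually_nhds_iff_ball.1
    (hC2.and (hyy.and (isLittleO_iff.1 hT hε)))
  have hmem : ∀ x y : ℝ, |x| < r → |y| < r → (x, y) ∈ Metric.ball (0 : ℝ × ℝ) r := by
    intro x y hx hy
    simpa [Prod.norm_def] using And.intro hx hy
  have hmono : ∀ x, |x| < r → StrictMonoOn (fun y => pdy F (x, y)) (Ioo (-r) r) := by
    intro x hx
    have hd : ∀ y ∈ Ioo (-r) r,
        HasDerivAt (fun y => pdy F (x, y)) (pdy (pdy F) (x, y)) y := fun y hy =>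
      hasDerivAt_snd_of_planeForm (hasFDerivAt_planeForm
        ((contDiffAt_pdy (hball _ (hmem x y hx (abs_lt.2 hy))).1).differentiableAt one_ne_zero))
    refine strictMonoOn_of_hasDerivWithinAt_pos (convex_Ioo _ _)
      (fun y hy => (hd y hy).continuousAt.continuousWithinAt)
      (fun y hy => (hd y (interior_subset hy)).hasDerivWithinAt) fun y hy => ?_
    have hy' : y ∈ Ioo (-r) r := interior_subset hy
    exact (hball _ (hmem x y hx (abs_lt.2 hy'))).2.1
  have hneg : ∀ x, x ≠ 0 → |x| < r → F (x, 0) < 0 := by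
    intro x hx0 hx
    have h := (hball _ (hmem x 0 hx (by simpa using hr))).2.2
    have h4 := min_le_left (-a) b
    have hx2 : 0 < x ^ 2 := by positivity
    simp only [Prod.norm_def, Real.norm_eq_abs, abs_zero, abs_nonneg, sup_of_le_left, abs_pow,
      sq_abs] at h
    nlinarith [(abs_le.1 h).2]
  have hpos : ∀ y, y ≠ 0 → |y| < r → 0 < F (0, y) := by
    intro y hy0 hy
    have h := (hball _ (hmem 0 y (by simpa using hr) hy)).2.2
    have h4 := min_le_right (-a) b
    have hy2 : 0 < y ^ 2 := by positivity
    simp only [Prod.norm_def, Real.norm_eq_abs, abs_zero, abs_nonneg, sup_of_le_right, abs_pow,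
      sq_abs] at h
    nlinarith [(abs_le.1 h).1]
  obtain ⟨δ, hδ, η, hη, hδr, hηr, Y, hY, hY0, hYneg⟩ := exists_isSignBranch hr
    (fun p hp => hder (hball p hp).1) hmono hF0 hneg hpos
  have hC2Y : ∀ x, |x| < δ → ∀ y ∈ Icc (-η) 0, ContDiffAt ℝ 2 F (x, y) := fun x hx y hy =>
    (hball _ (hmem x y (hx.trans hδr) (abs_lt.2 ⟨by linarith [hy.1], by linarith [hy.2]⟩))).1
  have hYcont : ∀ x, |x| < δ → ContinuousAt Y x := fun x hx =>
    hY.continuousAt (fun x hx y hy => (hC2Y x hx y hy).continuousAt) hx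
  refine ⟨δ, hδ, η, hη, Y, hY, hY0, hY.tendsto_div_abs hδ hη hFyy hs hs2 hT, ?_⟩
  intro S m hS h0 hSδ hm hms hlim
  refine contDiffOn_one_of_punctured (D := fun x => -pdx F (x, Y x) / pdy F (x, Y x)) hS h0 hY0
    (fun x hx hx0 => ?_) (fun x hx hx0 => ?_) hlim ?_
  · have hxδ := hSδ x hx
    exact hasDerivAt_of_implicit (hder (hC2Y x hxδ _ (hY.mem x hxδ))) (hYneg x hxδ hx0).ne
      (hYcont x hxδ) ((eventually_abs_lt hxδ).mono hY.zero)
  · have hxδ := hSδ x hx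
    have hg : ContinuousAt (fun x => (x, Y x)) x := continuousAt_id.prodMk (hYcont x hxδ)
    have hc := hC2Y x hxδ _ (hY.mem x hxδ)
    exact ((ContinuousAt.comp (f := fun x => (x, Y x)) (contDiffAt_pdx hc).continuousAt hg).neg).div
      (ContinuousAt.comp (f := fun x => (x, Y x)) (contDiffAt_pdy hc).continuousAt hg)
      (hYneg x hxδ hx0).ne
  · exact tendsto_neg_div_of_tendsto_div (nhdsWithin_mono _ fun x hx => hx.2) hFyy.ne' hm
      (by rw [hms]; exact hs2) hP hQ hlim

end PlaneZeroSet

/-- technical lemma: local description of the zero set of `F`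
near a boundary point where the boundary is tangent to the x-axis. -/
theorem zero_set_two_branches
    (Ω : Set (ℝ × ℝ)) (F : ℝ × ℝ → ℝ)
    (hΩopen : IsOpen Ω) (hΩne : Ω.Nonempty) (hΩbd : Bornology.IsBounded Ω)
    (hΩsm : SmoothBoundary Ω)
    (hΩhalf : Ω ⊆ {p : ℝ × ℝ | p.2 < 0})
    (h0bd : ((0, 0) : ℝ × ℝ) ∈ frontier Ω)
    (hF : ∃ V : Set (ℝ × ℝ), IsOpen V ∧ closure Ω ⊆ V ∧ ContDiffOn ℝ 2 F V)
    (hF0 : F ((0, 0) : ℝ × ℝ) = 0)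
    (hFx : pdx F ((0, 0) : ℝ × ℝ) = 0) (hFy : pdy F ((0, 0) : ℝ × ℝ) = 0)
    (hFxy : pdy (pdx F) ((0, 0) : ℝ × ℝ) = 0)
    (hFxx : pdx (pdx F) ((0, 0) : ℝ × ℝ) < 0)
    (hFyy : 0 < pdy (pdy F) ((0, 0) : ℝ × ℝ)) :
    ∃ δ > (0 : ℝ), ∃ η > (0 : ℝ), ∃ Y₁ Y₂ : ℝ → ℝ,
      ContDiffOn ℝ 1 Y₁ (Set.Icc (-δ) 0) ∧
      Set.MapsTo Y₁ (Set.Icc (-δ) 0) (Set.Icc (-η) 0) ∧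
      ContDiffOn ℝ 1 Y₂ (Set.Icc 0 δ) ∧
      Set.MapsTo Y₂ (Set.Icc 0 δ) (Set.Icc (-η) 0) ∧
      Y₁ 0 = 0 ∧ Y₂ 0 = 0 ∧
      derivWithin Y₁ (Set.Icc (-δ) 0) 0 =
        Real.sqrt (-(pdx (pdx F) ((0, 0) : ℝ × ℝ)) / pdy (pdy F) ((0, 0) : ℝ × ℝ)) ∧
      derivWithin Y₂ (Set.Icc 0 δ) 0 =
        -Real.sqrt (-(pdx (pdx F) ((0, 0) : ℝ × ℝ)) / pdy (pdy F) ((0, 0) : ℝ × ℝ)) ∧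
      ∀ p ∈ closure Ω ∩ Set.Icc (-δ) δ ×ˢ Set.Icc (-η) (0 : ℝ),
        (F p = 0 ↔
          (p.1 ∈ Set.Icc (-δ) (0 : ℝ) ∧ p.2 = Y₁ p.1) ∨
          (p.1 ∈ Set.Icc (0 : ℝ) δ ∧ p.2 = Y₂ p.1)) := by
  obtain ⟨V, hVopen, hVsub, hFV⟩ := hF
  have hC2 : ContDiffAt ℝ 2 F 0 :=
    hFV.contDiffAt (hVopen.mem_nhds (hVsub (frontier_subset_closure h0bd)))
  have hratio : 0 < -(pdx (pdx F) (0, 0)) / pdy (pdy F) (0, 0) :=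
    div_pos (neg_pos.2 hFxx) hFyy
  set s := Real.sqrt (-(pdx (pdx F) (0, 0)) / pdy (pdy F) (0, 0)) with hs
  have hspos : 0 < s := Real.sqrt_pos.2 hratio
  have hs2 : pdx (pdx F) (0, 0) + pdy (pdy F) (0, 0) * s ^ 2 = 0 := by
    rw [hs, Real.sq_sqrt hratio.le, mul_div_cancel₀ _ hFyy.ne']
    ring
  obtain ⟨δ, hδ, η, hη, Y, hY, hY0, hlim, hC1⟩ :=
    PlaneZeroSet.exists_zero_branch hC2 hF0 hFx hFy hFxy hFxx hFyy hspos hs2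
  have hlt : ∀ x, |x| ≤ δ / 2 → |x| < δ := fun x hx => by linarith
  have hleft : ∀ x ∈ Icc (-(δ / 2)) 0, |x| < δ := fun x hx =>
    hlt x (abs_le.2 ⟨hx.1, by linarith [hx.2]⟩)
  have hright : ∀ x ∈ Icc 0 (δ / 2), |x| < δ := fun x hx =>
    hlt x (abs_le.2 ⟨by linarith [hx.1], hx.2⟩)
  obtain ⟨hC1left, hDleft⟩ := hC1 (Icc (-(δ / 2)) 0) s (uniqueDiffOn_Icc (by linarith))
    ⟨by linarith, le_rfl⟩ hleft hspos.ne' rfl (by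
      have h := (hlim.mono_left (nhdsWithin_mono 0
        (fun x hx => hx.2 : Icc (-(δ / 2)) 0 \ {0} ⊆ {0}ᶜ))).neg
      rw [neg_neg] at h
      refine h.congr' ?_
      filter_upwards [self_mem_nhdsWithin] with x hx
      rw [abs_of_nonpos hx.1.2, div_neg, neg_neg])
  obtain ⟨hC1right, hDright⟩ := hC1 (Icc 0 (δ / 2)) (-s) (uniqueDiffOn_Icc (by linarith))
    ⟨le_rfl, by linarith⟩ hright (neg_ne_zero.2 hspos.ne') (neg_sq s) (by
      refine (hlim.mono_left (nhdsWithin_mono 0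
        (fun x hx => hx.2 : Icc 0 (δ / 2) \ {0} ⊆ {0}ᶜ))).congr' ?_
      filter_upwards [self_mem_nhdsWithin] with x hx
      rw [abs_of_nonneg hx.1.1])
  refine ⟨δ / 2, by positivity, η, hη, Y, Y, hC1left, fun x hx => hY.mem x (hleft x hx), hC1right,
    fun x hx => hY.mem x (hright x hx), hY0, hY0, hDleft, hDright, ?_⟩
  rintro ⟨x, y⟩ ⟨-, hx, hy⟩
  have hiff := hY.eq_zero_iff (hlt x (abs_le.2 hx)) hy
  rw [hiff]
  refine ⟨fun h => ?_, fun h => h.elim And.right And.right⟩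
  exact (le_total x 0).imp (fun h0 => ⟨⟨hx.1, h0⟩, h⟩) fun h0 => ⟨⟨h0, hx.2⟩, h⟩
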